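/- Let d ≥ 1, let V : ℝ^d → ℝ be a C^∞ function with V ≥ 0, and let R, C > 0 be such that |∇V(y)| ≥ 1/C whenever |y| ≥ R. Let λ ≥ 0 and let x₀ ∈ ℝ^d satisfy V(x₀) ≤ λ and |x₀| > R + λC. If T > 0 and x : [0,T] → ℝ^d is a C¹ curve with x(0) = x₀ and x'(t) = −∇V(x(t)) for all t ∈ [0,T], then for every t ∈ [0,T] one has |x(t)| > R and |x(t) − x₀| ≤ C·(V(x₀) − V(x(t))) ≤ λC. -/

import Mathlib

/-- Let `V : ℝ^d → ℝ` be `C^∞`, nonnegative, with `|∇V y| ≥ 1/C` whenever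
`|y| ≥ R`. Let `λ ≥ 0`, `V x₀ ≤ λ`, `|x₀| > R + λC`. If `x : [0,T] → ℝ^d` is a `C¹` curve with
`x 0 = x₀` solving `x' = -∇V(x)` on `[0,T]`, then for every `t ∈ [0,T]` one has `|x t| > R` and
`|x t − x₀| ≤ C (V x₀ − V (x t)) ≤ λ C`. -/
theorem stmt2 (d : ℕ) (hd : 1 ≤ d) (V : EuclideanSpace ℝ (Fin d) → ℝ)
    (hV : ContDiff ℝ (⊤ : ℕ∞) V) (hV0 : ∀ x, 0 ≤ V x)
    (R C : ℝ) (hR : 0 < R) (hC : 0 < C)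
    (hgrad : ∀ y : EuclideanSpace ℝ (Fin d), R ≤ ‖y‖ → 1 / C ≤ ‖gradient V y‖)
    (lam : ℝ) (hlam : 0 ≤ lam)
    (x₀ : EuclideanSpace ℝ (Fin d)) (hx₀V : V x₀ ≤ lam) (hx₀ : R + lam * C < ‖x₀‖)
    (T : ℝ) (hT : 0 < T) (x : ℝ → EuclideanSpace ℝ (Fin d))
    (hx0 : x 0 = x₀)
    (hode : ∀ t ∈ Set.Icc (0 : ℝ) T,
      HasDerivWithinAt x (-(gradient V (x t))) (Set.Icc (0 : ℝ) T) t) :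
    ∀ t ∈ Set.Icc (0 : ℝ) T,
      R < ‖x t‖ ∧ ‖x t - x₀‖ ≤ C * (V x₀ - V (x t)) ∧
        C * (V x₀ - V (x t)) ≤ lam * C := by
  have hxc : ContinuousOn x (Set.Icc 0 T) := fun t ht => (hode t ht).continuousWithinAt
  have hVx : ∀ t ∈ Set.Icc (0 : ℝ) T, HasDerivWithinAt (fun s => V (x s))
      (-(‖gradient V (x t)‖ ^ 2)) (Set.Icc (0 : ℝ) T) t := by
    intro t ht
    have hd1 : DifferentiableAt ℝ V (x t) := (hV.differentiable (by simp)).differentiableAt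
    have h := hd1.hasGradientAt.hasFDerivAt.comp_hasDerivWithinAt t (hode t ht)
    refine h.congr_deriv ?_
    rw [InnerProductSpace.toDual_apply_apply, inner_neg_right, real_inner_self_eq_norm_sq]
  have key : ∀ s ∈ Set.Icc (0 : ℝ) T, (∀ r ∈ Set.Ico (0 : ℝ) s, R ≤ ‖x r‖) →
      ‖x s - x₀‖ ≤ C * (V x₀ - V (x s)) := by
    intro s hs hr
    have hsub : Set.Icc (0 : ℝ) s ⊆ Set.Icc 0 T := Set.Icc_subset_Icc_right hs.2
    have hnhds : ∀ r ∈ Set.Ico (0 : ℝ) s, Set.Icc (0 : ℝ) T ∈ nhdsWithin r (Set.Ici r) := by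
      intro r hr
      exact Filter.mem_of_superset (Icc_mem_nhdsGE (lt_of_lt_of_le hr.2 hs.2))
        (Set.Icc_subset_Icc_left hr.1)
    refine image_norm_le_of_norm_deriv_right_le_deriv_boundary'
      (f := fun t => x t - x₀) (f' := fun t => -(gradient V (x t)))
      (B := fun t => C * (V x₀ - V (x t))) (B' := fun t => C * ‖gradient V (x t)‖ ^ 2)
      (a := 0) (b := s) ?_ ?_ ?_ ?_ ?_ ?_ ⟨hs.1, le_rfl⟩
    · exact (hxc.mono hsub).sub continuousOn_const
    · intro r h
      exact ((hode r (hsub ⟨h.1, h.2.le⟩)).mono_of_mem_nhdsWithin (hnhds r h)).sub_const _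
    · simp [hx0]
    · exact continuousOn_const.mul (continuousOn_const.sub
        (hV.continuous.comp_continuousOn (hxc.mono hsub)))
    · intro r h
      have h1 := (((hVx r (hsub ⟨h.1, h.2.le⟩)).mono_of_mem_nhdsWithin
        (hnhds r h)).const_sub (V x₀)).const_mul C
      simpa using h1
    · intro r h
      have h1 := hgrad _ (hr r h)
      rw [div_le_iff₀ hC] at h1
      rw [norm_neg]
      nlinarith [norm_nonneg (gradient V (x r))]
  have hle : ∀ t, C * (V x₀ - V (x t)) ≤ lam * C := by
    intro t
    nlinarith [hV0 (x t)]
  have gt_of : ∀ s, ‖x s - x₀‖ ≤ C * (V x₀ - V (x s)) → R < ‖x s‖ := by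
    intro s h
    have h1 := norm_sub_norm_le x₀ (x s)
    rw [norm_sub_rev] at h1
    linarith [hle s]
  have hall : ∀ t ∈ Set.Icc (0 : ℝ) T, R < ‖x t‖ := by
    by_contra! hcon
    obtain ⟨t, ht, htR⟩ := hcon
    have hcl : IsClosed (Set.Icc (0 : ℝ) T ∩ (fun t => ‖x t‖) ⁻¹' Set.Iic R) :=
      hxc.norm.preimage_isClosed_of_isClosed isClosed_Icc isClosed_Iic
    have hcp := isCompact_Icc.of_isClosed_subset hcl Set.inter_subset_left
    obtain ⟨s, hs, hmin⟩ := hcp.exists_isLeast ⟨t, ht, htR⟩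
    have h2 := gt_of s (key s hs.1 (fun r hr => by
      by_contra! hlt
      exact absurd (hmin ⟨⟨hr.1, hr.2.le.trans hs.1.2⟩, hlt.le⟩) (not_le.2 hr.2)))
    exact absurd hs.2 (not_le.2 h2)
  intro t ht
  exact ⟨hall t ht, key t ht (fun r hr => (hall r ⟨hr.1, hr.2.le.trans ht.2⟩).le), hle t⟩
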